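/- There is a constant ν > 0 such that for every sufficiently large n and every x ∈ 2^n with K(x) ≥ n − O(1), the string x has at least ν·n pairwise distinct weak sufficient set statistics. -/

import Mathlib

open scoped BigOperators
open scoped Classical

/-- The standard bijection between natural numbers and finite binary strings
(`ε ↦ 0`, `0 ↦ 1`, `1 ↦ 2`, `00 ↦ 3`, ...), inverse direction. -/
def strOfNat (n : ℕ) : List Bool := (n + 1).bits.dropLast

/-- Base-2 tetration: `1, 2, 2^2, 2^(2^2), ...`. -/
def tetr : ℕ → ℕ
  | 0 => 1
  | k + 1 => 2 ^ tetr k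

/-- The super-logarithm, the inverse of base-2 tetration. -/
noncomputable def slog (x : ℕ) : ℕ := sSup {k | tetr k ≤ x}

noncomputable section

/-- A machine given by a computable, monotone (in time) stepwise evaluation function
`step t p y n` : time `t`, program `p`, condition `y`, length parameter `n`
(the length parameter is always available). -/
structure Machine where
  step : ℕ → List Bool → ℕ → ℕ → Option ℕ
  computable_step :
    Computable fun q : (ℕ × List Bool) × ℕ × ℕ => step q.1.1 q.1.2 q.2.1 q.2.2
  mono : ∀ {t t' : ℕ} {p : List Bool} {y n v : ℕ}, t ≤ t' →
      step t p y n = some v → step t' p y n = some v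

namespace Machine

variable (M : Machine)

/-- `M(p|y,n) ↓ = v`. -/
def Outputs (p : List Bool) (y n v : ℕ) : Prop := ∃ t, M.step t p y n = some v

/-- `M(p|y,n) ↓`. -/
def HaltsOn (p : List Bool) (y n : ℕ) : Prop := ∃ v, M.Outputs p y n v

/-- the domain of `M` is prefix-free (for every condition). -/
def PrefixFree : Prop :=
  ∀ {p q : List Bool} {y n : ℕ}, M.HaltsOn p y n → M.HaltsOn q y n → p <+: q → p = q

/-- Kolmogorov complexity with respect to `M` (prefix-free complexity `K` when `M` is an
optimal prefix-free interpreter, plain complexity `C` when `M` is an optimal plain machine). -/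
def C (x y n : ℕ) : ℕ := sInf {l | ∃ p : List Bool, p.length = l ∧ M.Outputs p y n x}

/-- Time-bounded Kolmogorov complexity (`⊤` if no program produces `x` within time `t`). -/
def Ct (t x y n : ℕ) : ℕ∞ :=
  sInf {l : ℕ∞ | ∃ p : List Bool, (p.length : ℕ∞) = l ∧ M.step t p y n = some x}

/-- every value has a program, for every condition. -/
def Total : Prop := ∀ x y n, ∃ p : List Bool, M.Outputs p y n x

/-- `M` is an optimal universal prefix-free interpreter. -/
def POptimal : Prop := M.PrefixFree ∧ M.Total ∧
  ∀ N : Machine, N.PrefixFree → ∃ c, ∀ (p : List Bool) (y n v : ℕ),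
    N.Outputs p y n v → M.C v y n ≤ p.length + c

/-- `M` is an optimal universal plain machine. -/
def Optimal : Prop := M.Total ∧
  ∀ N : Machine, ∃ c, ∀ (p : List Bool) (y n v : ℕ),
    N.Outputs p y n v → M.C v y n ≤ p.length + c

/-- `p` is a shortest program for `x` (given `y`, `n`) on `M`. -/
def ShortestProg (p : List Bool) (x y n : ℕ) : Prop :=
  M.Outputs p y n x ∧ p.length = M.C x y n

/-- `u → v`: some program of length at most `c` computes `v` from `u` (and `n`). -/
def Computes (c u n v : ℕ) : Prop := ∃ q : List Bool, q.length ≤ c ∧ M.Outputs q u n v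

/-- `Ω^n_t`. -/
def OmegaT (n t : ℕ) : ℝ :=
  ∑' p : List Bool,
    if ∃ v, v < 2 ^ n ∧ M.step t p 0 n = some v then (2 : ℝ) ^ (-(p.length : ℤ)) else 0

/-- `Ω^n`. -/
def Omega (n : ℕ) : ℝ :=
  ∑' p : List Bool,
    if ∃ v, v < 2 ^ n ∧ M.Outputs p 0 n v then (2 : ℝ) ^ (-(p.length : ℤ)) else 0

/-- `t_k = min { t : Ω^n − Ω^n_t ≤ 2^{−k} }`. -/
def tk (n k : ℕ) : ℕ := sInf {t | M.Omega n - M.OmegaT n t ≤ (2 : ℝ) ^ (-(k : ℤ))}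

/-- the computational `m`-depth `k_x` of `x ∈ 2^n`, with additive constant `d`:
`k_x = min { k : K_{t_k}(x) ≤ K(x) + d }`. -/
def mdepth (d n x : ℕ) : ℕ :=
  sInf {k | ∃ p : List Bool, p.length ≤ M.C x 0 n + d ∧ M.step (M.tk n k) p 0 n = some x}

/-- `Ω^{n,j}`: the first `j` bits of the binary expansion of `Ω^n`, as a natural number. -/
def OmegaBits (n j : ℕ) : ℕ := ⌊M.Omega n * 2 ^ j⌋₊

/-- `H^{n,j}`: the first `j` bits of the Halting sequence `H^n` of `M`, as a natural number. -/
def Hbits (n j : ℕ) : ℕ :=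
  ∑ i ∈ Finset.range j, if M.HaltsOn (strOfNat i) 0 n then 2 ^ i else 0

/-- The Busy Beaver function of `M`: `BB(k) = max { M(p) : p ∈ 2^k, M(p)↓ }`. -/
def BB (n k : ℕ) : ℕ := sSup {v | ∃ p : List Bool, p.length = k ∧ M.Outputs p 0 n v}

end Machine

/-- `p` is a program on `M` computing the rational-valued function `P`. -/
def ProgForProb (M : Machine) (p : List Bool) (P : ℕ → ℚ) (n : ℕ) : Prop :=
  ∀ y, M.Outputs p y n (Encodable.encode (P y))

/-- Complexity of the function `P` with respect to `M`. -/
noncomputable def KProb (M : Machine) (n : ℕ) (P : ℕ → ℚ) : ℕ :=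
  sInf {l | ∃ p : List Bool, p.length = l ∧ ProgForProb M p P n}

/-- a (length conditional) semimeasure on `2^n`. -/
def IsSemimeasure (n : ℕ) (P : ℕ → ℚ) : Prop :=
  (∀ y, 0 ≤ P y) ∧ ∑ y ∈ Finset.range (2 ^ n), P y ≤ 1

/-- `p` is a program on `M` computing the partial function `F` (on binary strings). -/
def ProgForFun (M : Machine) (p : List Bool) (F : List Bool → Option ℕ) (n : ℕ) : Prop :=
  ∀ d v, F d = some v ↔ M.Outputs p (Encodable.encode d) n v

/-- `F` has prefix-free domain. -/
def PrefixFreeFun (F : List Bool → Option ℕ) : Prop :=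
  ∀ d d', (F d).isSome → (F d').isSome → d <+: d' → d = d'

/-- Complexity of the partial function `F` with respect to `M`. -/
noncomputable def KFun (M : Machine) (n : ℕ) (F : List Bool → Option ℕ) : ℕ :=
  sInf {l | ∃ p : List Bool, p.length = l ∧ ProgForFun M p F n}

/-- sufficient set statistic: `x ∈ S` and `K(S) + log|S| = K(x) ± c`. -/
def SufficientSet (Φ : Machine) (c n x : ℕ) (S : Finset ℕ) : Prop :=
  x ∈ S ∧ S ⊆ Finset.range (2 ^ n) ∧
    Nat.dist (Φ.C (Encodable.encode S) 0 n + Nat.log 2 S.card) (Φ.C x 0 n) ≤ c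

/-- sufficient probabilistic statistic: `P` computable semimeasure, `K(P) − log P(x) = K(x) ± c`. -/
def SufficientProb (Φ : Machine) (c n x : ℕ) (P : ℕ → ℚ) : Prop :=
  IsSemimeasure n P ∧ (∃ p, ProgForProb Φ p P n) ∧
    |(KProb Φ n P : ℝ) - Real.logb 2 (P x) - (Φ.C x 0 n : ℝ)| ≤ c

/-- sufficient function statistic: `F` computable prefix-free,
`K(F) + l(d) = K(x) ± c` for some `d` with `F(d) = x`. -/
def SufficientFun (Φ : Machine) (c n x : ℕ) (F : List Bool → Option ℕ) : Prop :=
  PrefixFreeFun F ∧ (∃ p, ProgForFun Φ p F n) ∧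
    ∃ d, F d = some x ∧ Nat.dist (KFun Φ n F + d.length) (Φ.C x 0 n) ≤ c

/-- minimal sufficient set statistic (within the constant `c`). -/
def MinimalSufficientSet (Φ : Machine) (c n x : ℕ) (S : Finset ℕ) : Prop :=
  SufficientSet Φ c n x S ∧ ∀ S' : Finset ℕ, SufficientSet Φ c n x S' →
    Φ.C (Encodable.encode S) 0 n ≤ Φ.C (Encodable.encode S') 0 n + c

/-- `l^S_x`: the complexity of a minimal sufficient set statistic. -/
noncomputable def lSet (Φ : Machine) (c n x : ℕ) : ℕ :=
  sInf {l | ∃ S : Finset ℕ, SufficientSet Φ c n x S ∧ Φ.C (Encodable.encode S) 0 n = l}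

/-- `l^P_x`: the complexity of a minimal sufficient probabilistic statistic. -/
noncomputable def lProb (Φ : Machine) (c n x : ℕ) : ℕ :=
  sInf {l | ∃ P : ℕ → ℚ, SufficientProb Φ c n x P ∧ KProb Φ n P = l}

/-- `l^F_x`: the complexity of a minimal sufficient function statistic. -/
noncomputable def lFun (Φ : Machine) (c n x : ℕ) : ℕ :=
  sInf {l | ∃ F : List Bool → Option ℕ, SufficientFun Φ c n x F ∧ KFun Φ n F = l}

/-- weak sufficient set statistic: `C(S) + log|S| = K(x|C(S)) ± c`
(`Φ` the prefix-free interpreter, `Ψ` the plain machine). -/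
def WeakSufficientSet (Φ Ψ : Machine) (c n x : ℕ) (S : Finset ℕ) : Prop :=
  x ∈ S ∧ S ⊆ Finset.range (2 ^ n) ∧
    Nat.dist (Ψ.C (Encodable.encode S) 0 n + Nat.log 2 S.card)
      (Φ.C x (Ψ.C (Encodable.encode S) 0 n) n) ≤ c

/-- weak sufficient probabilistic statistic: `C(P) − log P(x) = K(x|C(P)) ± c`. -/
def WeakSufficientProb (Φ Ψ : Machine) (c n x : ℕ) (P : ℕ → ℚ) : Prop :=
  IsSemimeasure n P ∧ (∃ p, ProgForProb Ψ p P n) ∧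
    |(KProb Ψ n P : ℝ) - Real.logb 2 (P x) - (Φ.C x (KProb Ψ n P) n : ℝ)| ≤ c

/-- weak sufficient function statistic: `C(F) + l(d) = K(x|C(F)) ± c` for some `d`, `F(d) = x`. -/
def WeakSufficientFun (Φ Ψ : Machine) (c n x : ℕ) (F : List Bool → Option ℕ) : Prop :=
  (∃ p, ProgForFun Ψ p F n) ∧
    ∃ d, F d = some x ∧ Nat.dist (KFun Ψ n F + d.length) (Φ.C x (KFun Ψ n F) n) ≤ c

/-- typical semimeasure: `−log P(x) = K(x|P*) ± c`, `P*` a shortest plain description of `P`. -/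
def TypicalProb (Φ Ψ : Machine) (c n x : ℕ) (P : ℕ → ℚ) : Prop :=
  IsSemimeasure n P ∧ (∃ p, ProgForProb Ψ p P n) ∧
    ∀ p : List Bool, ProgForProb Ψ p P n → p.length = KProb Ψ n P →
      |(-Real.logb 2 (P x)) - (Φ.C x (Encodable.encode p) n : ℝ)| ≤ c

/-- the `BB`-depth `k'_x` with additive constant `d`:
`k'_x = min { k : K_{BB(k)}(x|k) ≤ K(x|k) + d }`. -/
noncomputable def kBB (Φ Ψ : Machine) (d n x : ℕ) : ℕ :=
  sInf {k | ∃ p : List Bool, p.length ≤ Φ.C x k n + d ∧ Φ.step (Ψ.BB n k) p k n = some x}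

/-- The explicit weak sufficient statistic `P'_x`, with constants `d` (for `k'_x`),
`c` (scaling) and `c₂` (difference threshold):
`P'_x(y) = 2^{−K_{BB(k'_x)}(y|k'_x) + k'_x − c}` when
`K_{BB(k'_x)}(y|k'_x)` and `K_{BB(k'_x−1)}(y|k'_x)` differ by more than `c₂`, else `0`. -/
noncomputable def Pprime (Φ Ψ : Machine) (d c c₂ n x : ℕ) (y : ℕ) : ℚ :=
  if Φ.Ct (Ψ.BB n (kBB Φ Ψ d n x)) y (kBB Φ Ψ d n x) n + (c₂ : ℕ∞) <
      Φ.Ct (Ψ.BB n (kBB Φ Ψ d n x - 1)) y (kBB Φ Ψ d n x) n then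
    (2 : ℚ) ^ (kBB Φ Ψ d n x) /
      2 ^ (c + (Φ.Ct (Ψ.BB n (kBB Φ Ψ d n x)) y (kBB Φ Ψ d n x) n).toNat)
  else 0

/-- A prefix-free oracle machine: `step t p y n w` where `w` is the length-`t` initial
segment of the oracle which may be queried within `t` steps. -/
structure OracleMachine where
  step : ℕ → List Bool → ℕ → ℕ → List Bool → Option ℕ
  computable_step :
    Computable fun q : ((ℕ × List Bool) × ℕ × ℕ) × List Bool =>
      step q.1.1.1 q.1.1.2 q.1.2.1 q.1.2.2 q.2
  mono : ∀ {t t' : ℕ} {p : List Bool} {y n v : ℕ} (O : ℕ → Bool), t ≤ t' →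
      step t p y n (List.ofFn fun i : Fin t => O i) = some v →
      step t' p y n (List.ofFn fun i : Fin t' => O i) = some v

namespace OracleMachine

variable (M : OracleMachine) (O : ℕ → Bool)

def Outputs (p : List Bool) (y n v : ℕ) : Prop :=
  ∃ t, M.step t p y n (List.ofFn fun i : Fin t => O i) = some v

def HaltsOn (p : List Bool) (y n : ℕ) : Prop := ∃ v, M.Outputs O p y n v

def PrefixFree : Prop :=
  ∀ {p q : List Bool} {y n : ℕ}, M.HaltsOn O p y n → M.HaltsOn O q y n → p <+: q → p = q

/-- oracle Kolmogorov complexity `K^O`. -/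
def C (x y n : ℕ) : ℕ := sInf {l | ∃ p : List Bool, p.length = l ∧ M.Outputs O p y n x}

def Total : Prop := ∀ x y n, ∃ p : List Bool, M.Outputs O p y n x

/-- `M` is an optimal universal prefix-free machine relative to the oracle `O`. -/
def POptimal : Prop := M.PrefixFree O ∧ M.Total O ∧
  ∀ N : OracleMachine, N.PrefixFree O → ∃ c, ∀ (p : List Bool) (y n v : ℕ),
    N.Outputs O p y n v → M.C O v y n ≤ p.length + c

end OracleMachine

/-- The Halting sequence of `Φ` as a single oracle (pairing index and length parameter). -/
noncomputable def Hseq (Φ : Machine) : ℕ → Bool :=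
  fun i => decide (Φ.HaltsOn (strOfNat i.unpair.1) 0 i.unpair.2)

end

open Encodable

/-- The natural number with the given binary digits, most significant digit first. -/
def bval (p : List Bool) : ℕ := p.foldl (fun a b => 2 * a + b.toNat) 0

theorem bval_concat (p : List Bool) (b : Bool) : bval (p ++ [b]) = 2 * bval p + b.toNat := by
  simp [bval]

theorem exists_bval_eq (j a : ℕ) (ha : a < 2 ^ j) : ∃ p : List Bool, p.length = j ∧ bval p = a := by
  induction j generalizing a with
  | zero => exact ⟨[], rfl, by simp [bval]; omega⟩
  | succ j ih =>
    obtain ⟨p, hp, hv⟩ := ih (a / 2) (by rw [pow_succ] at ha; omega)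
    refine ⟨p ++ [decide (a % 2 = 1)], by simp [hp], ?_⟩
    rw [bval_concat, hv]
    rcases Nat.mod_two_eq_zero_or_one a with h | h <;> simp [h] <;> omega

theorem primrec_bval : Primrec bval := by
  refine Primrec.list_foldl (f := fun p => p) Primrec.id (Primrec.const 0)
    (h := fun (_ : List Bool) (q : ℕ × Bool) => 2 * q.1 + q.2.toNat) ?_
  exact Primrec.nat_add.comp
    (Primrec.nat_mul.comp (Primrec.const 2) (Primrec.fst.comp Primrec.snd))
    ((Primrec.dom_bool Bool.toNat).comp (Primrec.snd.comp Primrec.snd))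

theorem primrec_two_pow : Primrec fun m : ℕ => 2 ^ m := by
  refine (Primrec.nat_rec₁ 1 (f := fun _ r : ℕ => 2 * r)
    (Primrec.nat_mul.comp (Primrec.const 2) Primrec.snd)).of_eq fun m => ?_
  induction m with
  | zero => rfl
  | succ m ih => rw [pow_succ, ← ih, mul_comm]

theorem encode_finset_eq_encode_list (S : Finset ℕ) (l : List ℕ) (hl : l.Pairwise (· < ·))
    (h : ∀ a, a ∈ S ↔ a ∈ l) : encode S = encode l := by
  have hS : S.val = (l : Multiset ℕ) := by
    have : S = ⟨l, by exact Multiset.coe_nodup.2 (hl.imp fun h => ne_of_lt h)⟩ := by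
      ext
      simp [h]
    rw [this]
  rw [show encode S = encodeMultiset S.val from rfl, hS, encodeMultiset, Multiset.coe_sort]
  congr 1
  apply List.mergeSort_of_pairwise
  refine hl.imp fun h => ?_
  simp only [decide_eq_true_eq]
  exact h.le

/-- The `a`-th block of `w` consecutive numbers, as a list. -/
def blockList (a w : ℕ) : List ℕ := (List.range w).map fun i => a * w + i

theorem encode_block (a w : ℕ) :
    encode (Finset.Ico (a * w) ((a + 1) * w)) = encode (blockList a w) := by
  apply encode_finset_eq_encode_list
  · rw [blockList, List.pairwise_map]
    exact List.pairwise_lt_range.imp fun h => by omega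
  · intro b
    simp only [Finset.mem_Ico, blockList, List.mem_map, List.mem_range, add_mul, one_mul]
    constructor
    · exact fun ⟨h₁, h₂⟩ => ⟨b - a * w, by omega, by omega⟩
    · rintro ⟨i, hi, rfl⟩
      omega

theorem primrec_blockList : Primrec₂ blockList :=
  Primrec.list_map (Primrec.list_range.comp Primrec.snd)
    (Primrec.nat_add.comp
      (Primrec.nat_mul.comp (Primrec.fst.comp Primrec.fst) (Primrec.snd.comp Primrec.fst))
      Primrec.snd)

namespace Machine

theorem Outputs.unique {M : Machine} {p : List Bool} {y n v v' : ℕ} (h : M.Outputs p y n v)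
    (h' : M.Outputs p y n v') : v = v' := by
  obtain ⟨t, ht⟩ := h
  obtain ⟨t', ht'⟩ := h'
  have h₁ := M.mono (le_max_left t t') ht
  have h₂ := M.mono (le_max_right t t') ht'
  simpa using h₁.symm.trans h₂

theorem Total.exists_shortestProg {M : Machine} (hM : M.Total) (x y n : ℕ) :
    ∃ p, M.ShortestProg p x y n := by
  obtain ⟨p, hp⟩ := hM x y n
  obtain ⟨q, hq, hq'⟩ := Nat.sInf_mem (s := {l | ∃ p : List Bool, p.length = l ∧ M.Outputs p y n x})
    ⟨_, p, rfl, hp⟩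
  exact ⟨q, hq', hq⟩

theorem exists_code (M : Machine) : ∃ c : Nat.Partrec.Code, ∀ (p : List Bool) (y n v : ℕ),
    M.Outputs p y n v ↔ v ∈ c.eval (encode (p, y, n)) := by
  have h : Partrec fun q : List Bool × ℕ × ℕ =>
      Nat.rfindOpt fun t => M.step t q.1 q.2.1 q.2.2 :=
    Partrec.rfindOpt (M.computable_step.comp
      ((Computable.snd.pair (Computable.fst.comp Computable.fst)).pair
        (Computable.snd.comp Computable.fst)))
  obtain ⟨c, hc⟩ := Nat.Partrec.Code.exists_code.1 h
  refine ⟨c, fun p y n v => ?_⟩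
  rw [hc]
  simp only [encodek, Part.coe_some, Part.bind_some, Part.mem_map_iff]
  have key : ∀ w, w ∈ Nat.rfindOpt (fun t => M.step t p y n) ↔ M.Outputs p y n w := fun w =>
    Nat.rfindOpt_mono fun hmn ha => M.mono hmn ha
  simp [key]

/-- The machine printing the block of length-`n` strings that extend its program. -/
def cylinderMachine : Machine where
  step _ p _ n := some (encode (blockList (bval p) (2 ^ (n - p.length))))
  computable_step := by
    have hp : Primrec fun q : (ℕ × List Bool) × ℕ × ℕ => q.1.2 := Primrec.snd.comp Primrec.fst
    have hn : Primrec fun q : (ℕ × List Bool) × ℕ × ℕ => q.2.2 := Primrec.snd.comp Primrec.snd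
    exact (Primrec.option_some.comp (Primrec.encode.comp (primrec_blockList.comp
      (primrec_bval.comp hp) (primrec_two_pow.comp
        (Primrec.nat_sub.comp hn (Primrec.list_length.comp hp)))))).to_comp
  mono _ h := h

/-- Under the condition `y`, this machine splits its program into a description of length `y` of
a finite set with respect to `M` and the index of an element of that set. -/
def memberMachine (M : Machine) : Machine where
  step t q y n := (M.step t (q.take y) 0 n).bind fun v => (decode (α := List ℕ) v).bind fun l =>
    if y ≤ q.length ∧ l.length = 2 ^ (q.length - y) then some (l.getD (bval (q.drop y)) 0) else none
  computable_step := by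
    have hq : Primrec fun q : (ℕ × List Bool) × ℕ × ℕ => q.1.2 := Primrec.snd.comp Primrec.fst
    have hy : Primrec fun q : (ℕ × List Bool) × ℕ × ℕ => q.2.1 := Primrec.fst.comp Primrec.snd
    have hf : Primrec fun r : (((ℕ × List Bool) × ℕ × ℕ) × ℕ) × List ℕ => r.1.1 :=
      Primrec.fst.comp Primrec.fst
    have hlen := Primrec.list_length.comp (hq.comp hf)
    have hb : Primrec₂ fun (r : ((ℕ × List Bool) × ℕ × ℕ) × ℕ) (l : List ℕ) =>
        if r.1.2.1 ≤ r.1.1.2.length ∧ l.length = 2 ^ (r.1.1.2.length - r.1.2.1) then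
          some (l.getD (bval (r.1.1.2.drop r.1.2.1)) 0) else none :=
      Primrec.ite
        ((Primrec.nat_le.comp (hy.comp hf) hlen).and
          (Primrec.eq.comp (Primrec.list_length.comp Primrec.snd)
            (primrec_two_pow.comp (Primrec.nat_sub.comp hlen (hy.comp hf)))))
        (Primrec.option_some.comp ((Primrec.list_getD 0).comp Primrec.snd
          (primrec_bval.comp (Primrec.list_drop.comp (hy.comp hf) (hq.comp hf)))))
        (Primrec.const none)
    have hg : Primrec fun q : (ℕ × List Bool) × ℕ × ℕ =>
        (((q.1.1, q.1.2.take q.2.1), 0, q.2.2) : (ℕ × List Bool) × ℕ × ℕ) :=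
      ((Primrec.fst.comp Primrec.fst).pair (Primrec.list_take.comp hy hq)).pair
        ((Primrec.const 0).pair (Primrec.snd.comp Primrec.snd))
    have hM := M.computable_step.comp hg.to_comp
    have hd : Primrec₂ fun (q : (ℕ × List Bool) × ℕ × ℕ) (v : ℕ) =>
        (decode (α := List ℕ) v).bind fun l =>
          if q.2.1 ≤ q.1.2.length ∧ l.length = 2 ^ (q.1.2.length - q.2.1) then
            some (l.getD (bval (q.1.2.drop q.2.1)) 0) else none :=
      Primrec.option_bind (Primrec.decode.comp Primrec.snd) hb
    exact Computable.option_bind hM hd.to_comp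
  mono := by
    intro t t' p y n v htt h
    obtain ⟨u, hu, h⟩ := Option.bind_eq_some_iff.1 h
    exact Option.bind_eq_some_iff.2 ⟨u, M.mono htt hu, h⟩

theorem memberMachine_outputs {M : Machine} {q : List Bool} {y n v : ℕ} :
    (memberMachine M).Outputs q y n v ↔ ∃ u, M.Outputs (q.take y) 0 n u ∧
      ∃ l : List ℕ, decode u = some l ∧ (y ≤ q.length ∧ l.length = 2 ^ (q.length - y)) ∧
        l.getD (bval (q.drop y)) 0 = v := by
  simp only [Outputs, memberMachine, Option.bind_eq_some_iff, Option.ite_none_right_eq_some,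
    Option.some.injEq]
  constructor
  · rintro ⟨t, u, h, h'⟩
    exact ⟨u, ⟨t, h⟩, h'⟩
  · rintro ⟨u, ⟨t, h⟩, h'⟩
    exact ⟨t, u, h, h'⟩

theorem memberMachine_prefixFree (M : Machine) : (memberMachine M).PrefixFree := by
  rintro p q y n ⟨v, hv⟩ ⟨v', hv'⟩ hpq
  obtain ⟨u, hu, l, hl, ⟨hy, hlen⟩, -⟩ := memberMachine_outputs.1 hv
  obtain ⟨u', hu', l', hl', ⟨hy', hlen'⟩, -⟩ := memberMachine_outputs.1 hv'
  have htake : q.take y = p.take y := by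
    obtain ⟨r, rfl⟩ := hpq
    exact List.take_append_of_le_length hy
  rw [htake] at hu'
  obtain rfl := hu.unique hu'
  obtain rfl : l = l' := by simpa using hl.symm.trans hl'
  have := Nat.pow_right_injective le_rfl (hlen.symm.trans hlen')
  exact hpq.eq_of_length (by omega)

end Machine

/-- Elements `x` with `P t x` for some `t`, listed without repetition in order of appearance. -/
noncomputable def enumList (P : ℕ → ℕ → Prop) : ℕ → List ℕ
  | 0 => []
  | T + 1 =>
    if P T.unpair.1 T.unpair.2 ∧ (enumList P T).length ≤ (enumList P T).idxOf T.unpair.2 then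
      enumList P T ++ [T.unpair.2]
    else enumList P T

section enumList

variable {P : ℕ → ℕ → Prop}

theorem enumList_prefix {T T' : ℕ} (h : T ≤ T') : enumList P T <+: enumList P T' := by
  induction T', h using Nat.le_induction with
  | base => exact List.prefix_rfl
  | succ T' _ ih =>
    refine ih.trans ?_
    rw [enumList]
    split_ifs
    · exact List.prefix_append _ _
    · exact List.prefix_rfl

theorem enumList_nodup (T : ℕ) : (enumList P T).Nodup := by
  induction T with
  | zero => simp [enumList]
  | succ T ih =>
    rw [enumList]
    split_ifs with h
    · have : T.unpair.2 ∉ enumList P T := fun hm =>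
        absurd (List.idxOf_lt_length_of_mem hm) (not_lt.2 h.2)
      rw [List.nodup_append]
      refine ⟨ih, by simp, ?_⟩
      rintro a ha b hb rfl
      simp only [List.mem_singleton] at hb
      exact this (hb ▸ ha)
    · exact ih

theorem exists_of_mem_enumList {T x : ℕ} (h : x ∈ enumList P T) : ∃ t, P t x := by
  induction T with
  | zero => simp [enumList] at h
  | succ T ih =>
    rw [enumList] at h
    split_ifs at h with h'
    · rcases List.mem_append.1 h with h | h
      · exact ih h
      · obtain rfl := List.mem_singleton.1 h
        exact ⟨_, h'.1⟩
    · exact ih h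

theorem exists_mem_enumList {t x : ℕ} (h : P t x) : ∃ T, x ∈ enumList P T := by
  refine ⟨Nat.pair t x + 1, ?_⟩
  rw [enumList]
  split_ifs with h'
  · simp
  · simp only [Nat.unpair_pair, h, true_and, not_le] at h'
    exact List.idxOf_lt_length_iff.1 h'

theorem primrec_enumList {α : Type*} [Primcodable α] {P : α → ℕ → ℕ → Prop}
    (hP : PrimrecPred fun q : α × ℕ × ℕ => P q.1 q.2.1 q.2.2) :
    Primrec₂ fun a T => enumList (P a) T := by
  have hL : Primrec fun r : α × ℕ × List ℕ => r.2.2 := Primrec.snd.comp Primrec.snd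
  have hu : Primrec fun r : α × ℕ × List ℕ => r.2.1.unpair :=
    Primrec.unpair.comp (Primrec.fst.comp Primrec.snd)
  have hx := Primrec.snd.comp hu
  have hstep : Primrec₂ fun (a : α) (q : ℕ × List ℕ) =>
      if P a q.1.unpair.1 q.1.unpair.2 ∧ q.2.length ≤ q.2.idxOf q.1.unpair.2 then
        q.2 ++ [q.1.unpair.2] else q.2 :=
    Primrec.ite
      ((hP.comp (Primrec.fst.pair ((Primrec.fst.comp hu).pair hx))).and
        (Primrec.nat_le.comp (Primrec.list_length.comp hL) (Primrec.list_idxOf.comp hx hL)))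
      (Primrec.list_concat.comp hL hx) hL
  refine (Primrec.nat_rec (Primrec.const []) hstep).of_eq fun a T => ?_
  induction T with
  | zero => rfl
  | succ T ih => simp only [ih, enumList]

end enumList

namespace Machine

/-- The machine whose programs `1^e 0 w` with `|w| = n - 2e` print the element with index `w` in
the enumeration associated with `P (n, e)`. -/
noncomputable def enumMachine (P : ℕ × ℕ → ℕ → ℕ → Prop)
    (hP : PrimrecPred fun q : (ℕ × ℕ) × ℕ × ℕ => P q.1 q.2.1 q.2.2) : Machine where
  step T q _ n :=
    if q.idxOf false < q.length ∧ q.length + q.idxOf false = n + 1 then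
      (enumList (P (n, q.idxOf false)) T)[bval (q.drop (q.idxOf false + 1))]? else none
  computable_step := by
    have hT : Primrec fun r : (ℕ × List Bool) × ℕ × ℕ => r.1.1 := Primrec.fst.comp Primrec.fst
    have hq : Primrec fun r : (ℕ × List Bool) × ℕ × ℕ => r.1.2 := Primrec.snd.comp Primrec.fst
    have hn : Primrec fun r : (ℕ × List Bool) × ℕ × ℕ => r.2.2 := Primrec.snd.comp Primrec.snd
    have he : Primrec fun r : (ℕ × List Bool) × ℕ × ℕ => r.1.2.idxOf false :=
      Primrec.list_idxOf.comp (Primrec.const false) hq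
    have hl := Primrec.list_length.comp hq
    exact (Primrec.ite
      ((Primrec.nat_lt.comp he hl).and
        (Primrec.eq.comp (Primrec.nat_add.comp hl he) (Primrec.succ.comp hn)))
      (Primrec.list_getElem?.comp ((primrec_enumList hP).comp (hn.pair he) hT)
        (primrec_bval.comp (Primrec.list_drop.comp (Primrec.succ.comp he) hq)))
      (Primrec.const none)).to_comp
  mono := by
    intro t t' p y n v htt h
    simp only [Option.ite_none_right_eq_some] at h ⊢
    obtain ⟨r, hr⟩ := enumList_prefix (P := P (n, p.idxOf false)) htt
    obtain ⟨hi, -⟩ := List.getElem?_eq_some_iff.1 h.2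
    exact ⟨h.1, by rw [← hr, List.getElem?_append_left hi, h.2]⟩

theorem enumMachine_prefixFree (P : ℕ × ℕ → ℕ → ℕ → Prop)
    (hP : PrimrecPred fun q : (ℕ × ℕ) × ℕ × ℕ => P q.1 q.2.1 q.2.2) :
    (enumMachine P hP).PrefixFree := by
  rintro p q y n ⟨v, t, h⟩ ⟨v', t', h'⟩ hpq
  simp only [enumMachine, Option.ite_none_right_eq_some] at h h'
  have : q.idxOf false = p.idxOf false := by
    obtain ⟨r, rfl⟩ := hpq
    exact List.idxOf_append_of_mem (List.idxOf_lt_length_iff.1 h.1.1)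
  exact hpq.eq_of_length (by omega)

/-- An element of an enumerable set with at most `2^(n - 2e)` elements has a description that is
shorter than `n` by about `e` bits. -/
theorem POptimal.exists_C_add_le {Φ : Machine} (hΦ : Φ.POptimal) (P : ℕ × ℕ → ℕ → ℕ → Prop)
    (hP : PrimrecPred fun q : (ℕ × ℕ) × ℕ × ℕ => P q.1 q.2.1 q.2.2) :
    ∃ c, ∀ n e x t, P (n, e) t x →
      (∀ s : Finset ℕ, (∀ y ∈ s, ∃ t, P (n, e) t y) → s.card * 2 ^ (2 * e) ≤ 2 ^ n) →
      Φ.C x 0 n + e ≤ n + c := by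
  obtain ⟨c, hc⟩ := hΦ.2.2 (enumMachine P hP) (enumMachine_prefixFree P hP)
  refine ⟨c + 1, fun n e x t hx hcard => ?_⟩
  obtain ⟨T, hT⟩ := exists_mem_enumList hx
  obtain ⟨i, hi, hix⟩ := List.getElem_of_mem hT
  have hle : (enumList (P (n, e)) T).length * 2 ^ (2 * e) ≤ 2 ^ n := by
    rw [← List.toFinset_card_of_nodup (enumList_nodup T)]
    exact hcard _ fun y hy => exists_of_mem_enumList (List.mem_toFinset.1 hy)
  have hen : 2 * e ≤ n := by
    refine (Nat.pow_le_pow_iff_right one_lt_two).1 (le_trans ?_ hle)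
    exact Nat.le_mul_of_pos_left _ (by omega)
  have hi' : i < 2 ^ (n - 2 * e) := by
    have : (enumList (P (n, e)) T).length ≤ 2 ^ (n - 2 * e) := by
      refine Nat.le_of_mul_le_mul_right (hle.trans_eq ?_) (Nat.two_pow_pos (2 * e))
      rw [← pow_add, Nat.sub_add_cancel hen]
    omega
  obtain ⟨w, hw, hwi⟩ := exists_bval_eq _ _ hi'
  have hidx : (List.replicate e true ++ false :: w).idxOf false = e := by
    rw [List.idxOf_append_of_notMem (by simp)]
    simp
  have hdrop : (List.replicate e true ++ false :: w).drop (e + 1) = w := by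
    rw [List.drop_append]
    simp
  have := hc (List.replicate e true ++ false :: w) 0 n x ⟨T, by
    simp only [enumMachine, hidx, hdrop, hwi, Option.ite_none_right_eq_some]
    exact ⟨by simp [hw]; omega, by rw [List.getElem?_eq_getElem hi, hix]⟩⟩
  simp [hw] at this
  omega

/-- Given its length, a member of a finite set can be described by a shortest plain description of
the set together with its index. -/
theorem POptimal.exists_C_le_add {Φ : Machine} (hΦ : Φ.POptimal) {Ψ : Machine} (hΨ : Ψ.Total) :
    ∃ c, ∀ n x m, Φ.C x (Ψ.C (encode (Finset.Ico (x / 2 ^ m * 2 ^ m) ((x / 2 ^ m + 1) * 2 ^ m))) 0 n)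
      n ≤ Ψ.C (encode (Finset.Ico (x / 2 ^ m * 2 ^ m) ((x / 2 ^ m + 1) * 2 ^ m))) 0 n + m + c := by
  obtain ⟨c, hc⟩ := hΦ.2.2 (memberMachine Ψ) (memberMachine_prefixFree Ψ)
  refine ⟨c, fun n x m => ?_⟩
  rw [encode_block]
  obtain ⟨p, hp, hlen⟩ := hΨ.exists_shortestProg (encode (blockList (x / 2 ^ m) (2 ^ m))) 0 n
  have hmod : x % 2 ^ m < 2 ^ m := Nat.mod_lt _ (Nat.two_pow_pos m)
  obtain ⟨w, hw, hwv⟩ := exists_bval_eq m (x % 2 ^ m) hmod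
  rw [← hlen]
  refine (hc (p ++ w) p.length n x (memberMachine_outputs.2 ?_)).trans_eq (by simp [hw])
  refine ⟨_, by simpa using hp, _, encodek _, by simp [blockList, hw], ?_⟩
  have := Nat.div_add_mod' x (2 ^ m)
  simp [blockList, hwv, hmod, this]

theorem Optimal.exists_C_cylinder_le {Ψ : Machine} (hΨ : Ψ.Optimal) :
    ∃ c, ∀ n x j, j ≤ n → x < 2 ^ n →
      Ψ.C (encode (Finset.Ico (x / 2 ^ (n - j) * 2 ^ (n - j)) ((x / 2 ^ (n - j) + 1) * 2 ^ (n - j))))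
        0 n ≤ j + c := by
  obtain ⟨c, hc⟩ := hΨ.2 cylinderMachine
  refine ⟨c, fun n x j hj hx => ?_⟩
  obtain ⟨p, rfl, hv⟩ := exists_bval_eq j (x / 2 ^ (n - j))
    (Nat.div_lt_of_lt_mul (by rwa [← pow_add, Nat.sub_add_cancel hj]))
  refine hc p 0 n _ ⟨0, ?_⟩
  rw [encode_block, ← hv]
  rfl

end Machine

/-- An injective numbering of binary strings. -/
def strCode : List Bool → ℕ
  | [] => 1
  | b :: p => 2 * strCode p + b.toNat

theorem strCode_pos (p : List Bool) : 0 < strCode p := by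
  induction p with
  | nil => simp [strCode]
  | cons b p ih => simp only [strCode]; omega

theorem strCode_lt (p : List Bool) : strCode p < 2 ^ (p.length + 1) := by
  induction p with
  | nil => simp [strCode]
  | cons b p ih =>
    have := Bool.toNat_le b
    simp only [strCode, List.length_cons]
    rw [pow_succ]
    omega

theorem strCode_injective : Function.Injective strCode := by
  intro p
  induction p with
  | nil =>
    intro q h
    cases q with
    | nil => rfl
    | cons b q =>
      have := strCode_pos q
      simp only [strCode] at h
      omega
  | cons a p ih =>
    intro q h
    cases q with
    | nil =>
      have := strCode_pos p
      simp only [strCode] at h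
      omega
    | cons b q =>
      have ha := Bool.toNat_le a
      have hb := Bool.toNat_le b
      simp only [strCode] at h
      rw [ih (show strCode p = strCode q by omega),
        show a = b by cases a <;> cases b <;> simp_all <;> omega]

theorem card_mul_two_pow_le {α : Type*} (s : Finset α) (g : α → List Bool)
    (hg : Set.InjOn g s) (a b : ℕ) (h : ∀ x ∈ s, (g x).length + a ≤ b) :
    s.card * 2 ^ a ≤ 2 ^ (b + 1) := by
  rcases s.eq_empty_or_nonempty with rfl | ⟨x₀, hx₀⟩
  · simp
  have hab := h x₀ hx₀
  have : s.card ≤ (Finset.range (2 ^ (b + 1 - a))).card := by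
    refine Finset.card_le_card_of_injOn (fun x => strCode (g x)) (fun x hx => ?_)
      fun x hx y hy hxy => hg hx hy (strCode_injective hxy)
    have hx' := h x hx
    simp only [Finset.coe_range, Set.mem_Iio]
    exact (strCode_lt _).trans_le (Nat.pow_le_pow_right two_pos (by omega))
  rw [Finset.card_range] at this
  calc s.card * 2 ^ a ≤ 2 ^ (b + 1 - a) * 2 ^ a := Nat.mul_le_mul_right _ this
    _ = 2 ^ (b + 1) := by rw [← pow_add]; congr 1; omega

theorem replicate_append_injective {d d' : ℕ} {p p' : List Bool}
    (h : List.replicate d true ++ false :: p = List.replicate d' true ++ false :: p') :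
    d = d' ∧ p = p' := by
  induction d generalizing d' with
  | zero => cases d' <;> simp_all [List.replicate_succ]
  | succ d ih =>
    cases d' with
    | zero => simp [List.replicate_succ] at h
    | succ d' =>
      simp only [List.replicate_succ, List.cons_append, List.cons.injEq, true_and] at h
      simpa using ih h

namespace Machine

/-- Given some `k ≤ j + b`, the complexity of `x` is below `k + n - j` by at least `a`. -/
def Compressible (Φ : Machine) (b n a j x : ℕ) : Prop :=
  ∃ k ≤ j + b, ∃ p, Φ.Outputs p k n x ∧ p.length + j + a ≤ k + n

theorem card_compressible_mul_le (Φ : Machine) (b n a j : ℕ) (s : Finset ℕ)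
    (hs : ∀ x ∈ s, Φ.Compressible b n a j x) : s.card * 2 ^ a ≤ 2 ^ (n + b + 2) := by
  have : ∀ x, ∃ d p, x ∈ s → d ≤ j + b ∧ Φ.Outputs p (j + b - d) n x ∧
      p.length + d + a ≤ n + b := by
    intro x
    by_cases hx : x ∈ s
    · obtain ⟨k, hk, p, hp, hlen⟩ := hs x hx
      refine ⟨j + b - k, p, fun _ => ⟨by omega, ?_, by omega⟩⟩
      rwa [Nat.sub_sub_self hk]
    · exact ⟨0, [], fun h => absurd h hx⟩
  choose d p hdp using this
  refine card_mul_two_pow_le s (fun x => List.replicate (d x) true ++ false :: p x) ?_ a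
    (n + b + 1) fun x hx => ?_
  · intro x hx y hy hxy
    obtain ⟨h₁, h₂⟩ := replicate_append_injective hxy
    have hx' := (hdp x hx).2.1
    rw [h₁, h₂] at hx'
    exact hx'.unique (hdp y hy).2.1
  · have := (hdp x hx).2.2
    simp only [List.length_append, List.length_replicate, List.length_cons]
    omega

theorem card_often_compressible_mul_le (Φ : Machine) (b n e : ℕ) (hn : 0 < n) (s : Finset ℕ)
    (hs : ∀ x ∈ s, n ≤ 2 * {j ∈ Finset.range n | Φ.Compressible b n (2 * e + b + 3) j x}.card) :
    s.card * 2 ^ (2 * e) ≤ 2 ^ n := by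
  have hdouble : ∑ x ∈ s, {j ∈ Finset.range n | Φ.Compressible b n (2 * e + b + 3) j x}.card =
      ∑ j ∈ Finset.range n, {x ∈ s | Φ.Compressible b n (2 * e + b + 3) j x}.card :=
    Finset.sum_card_bipartiteAbove_eq_sum_card_bipartiteBelow _
  have h₁ : s.card * n ≤
      2 * ∑ j ∈ Finset.range n, {x ∈ s | Φ.Compressible b n (2 * e + b + 3) j x}.card := by
    rw [← hdouble, Finset.mul_sum, ← smul_eq_mul]
    exact Finset.card_nsmul_le_sum _ _ _ hs
  have h₂ : (∑ j ∈ Finset.range n, {x ∈ s | Φ.Compressible b n (2 * e + b + 3) j x}.card) *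
      2 ^ (2 * e + b + 3) ≤ n * 2 ^ (n + b + 2) := by
    rw [Finset.sum_mul]
    refine (Finset.sum_le_card_nsmul _ _ (2 ^ (n + b + 2)) fun j _ =>
      Φ.card_compressible_mul_le b n _ j _ fun x hx => (Finset.mem_filter.1 hx).2).trans_eq ?_
    simp
  refine Nat.le_of_mul_le_mul_right (c := n * 2 ^ (b + 3)) ?_ (by positivity)
  calc s.card * 2 ^ (2 * e) * (n * 2 ^ (b + 3)) = s.card * n * 2 ^ (2 * e + b + 3) := by ring
    _ ≤ 2 * (n * 2 ^ (n + b + 2)) := by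
      refine (Nat.mul_le_mul_right _ h₁).trans ?_
      rw [mul_assoc]
      exact Nat.mul_le_mul_left _ h₂
    _ = 2 ^ n * (n * 2 ^ (b + 3)) := by ring

end Machine

/-- Stage `T` of an enumeration of `Machine.Compressible` for a machine with code `c`: the
witness `m` encodes a program, a condition and the length parameter. -/
def CompressibleAt (c : Nat.Partrec.Code) (b n a j x T : ℕ) : Prop :=
  ∃ m ∈ List.range T, c.evaln T m = some x ∧
    encode ((decode (α := List Bool × ℕ × ℕ) m).getD default) = m ∧
    ((decode (α := List Bool × ℕ × ℕ) m).getD default).2.2 = n ∧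
    ((decode (α := List Bool × ℕ × ℕ) m).getD default).2.1 ≤ j + b ∧
    ((decode (α := List Bool × ℕ × ℕ) m).getD default).1.length + j + a ≤
      ((decode (α := List Bool × ℕ × ℕ) m).getD default).2.1 + n

theorem CompressibleAt.mono {c : Nat.Partrec.Code} {b n a j x T T' : ℕ} (hT : T ≤ T')
    (h : CompressibleAt c b n a j x T) : CompressibleAt c b n a j x T' := by
  obtain ⟨m, hm, hx, h⟩ := h
  rw [List.mem_range] at hm
  exact ⟨m, List.mem_range.2 (hm.trans_le hT), Nat.Partrec.Code.evaln_mono hT hx, h⟩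

theorem exists_compressibleAt_iff {Φ : Machine} {c : Nat.Partrec.Code}
    (hc : ∀ (p : List Bool) (y n v : ℕ), Φ.Outputs p y n v ↔ v ∈ c.eval (encode (p, y, n)))
    (b n a j x : ℕ) : (∃ T, CompressibleAt c b n a j x T) ↔ Φ.Compressible b n a j x := by
  constructor
  · rintro ⟨T, m, -, hx, hm, hn, hk, hlen⟩
    generalize (decode (α := List Bool × ℕ × ℕ) m).getD default = q at hm hn hk hlen
    subst hm hn
    exact ⟨q.2.1, hk, q.1, (hc _ _ _ _).2 (Nat.Partrec.Code.evaln_sound hx), hlen⟩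
  · rintro ⟨k, hk, p, hp, hlen⟩
    obtain ⟨T, hT⟩ := Nat.Partrec.Code.evaln_complete.1 ((hc _ _ _ _).1 hp)
    exact ⟨T, encode (p, k, n), List.mem_range.2 (Nat.Partrec.Code.evaln_bound hT), hT,
      by simp, by simp, by simpa using hk, by simpa using hlen⟩

theorem primrecPred_compressibleAt (c : Nat.Partrec.Code) (b : ℕ) :
    PrimrecRel fun (j : ℕ) (r : (ℕ × ℕ) × ℕ × ℕ) =>
      CompressibleAt c b r.1.1 (2 * r.1.2 + b + 3) j r.2.2 r.2.1 := by
  have hm : Primrec fun q : ℕ × ℕ × (ℕ × ℕ) × ℕ × ℕ => q.1 := Primrec.fst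
  have hj : Primrec fun q : ℕ × ℕ × (ℕ × ℕ) × ℕ × ℕ => q.2.1 := Primrec.fst.comp Primrec.snd
  have hr : Primrec fun q : ℕ × ℕ × (ℕ × ℕ) × ℕ × ℕ => q.2.2 := Primrec.snd.comp Primrec.snd
  have hn := (Primrec.fst.comp Primrec.fst).comp hr
  have he := (Primrec.snd.comp Primrec.fst).comp hr
  have hT := (Primrec.fst.comp Primrec.snd).comp hr
  have hx := (Primrec.snd.comp Primrec.snd).comp hr
  have hd : Primrec fun q : ℕ × ℕ × (ℕ × ℕ) × ℕ × ℕ =>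
      (decode (α := List Bool × ℕ × ℕ) q.1).getD default :=
    Primrec.option_getD.comp (Primrec.decode.comp hm) (Primrec.const default)
  have hk := (Primrec.fst.comp Primrec.snd).comp hd
  have hev : PrimrecPred fun q : ℕ × ℕ × (ℕ × ℕ) × ℕ × ℕ => c.evaln q.2.2.2.1 q.1 = some q.2.2.2.2 :=
    Primrec.eq.comp (Nat.Partrec.Code.primrec_evaln.comp ((hT.pair (Primrec.const c)).pair hm))
      (Primrec.option_some.comp hx)
  have ha : Primrec fun q : ℕ × ℕ × (ℕ × ℕ) × ℕ × ℕ => 2 * q.2.2.1.2 + b + 3 :=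
    Primrec.nat_add.comp (Primrec.nat_add.comp (Primrec.nat_mul.comp (Primrec.const 2) he)
      (Primrec.const b)) (Primrec.const 3)
  have hrel : PrimrecRel fun (m : ℕ) (r : ℕ × (ℕ × ℕ) × ℕ × ℕ) =>
      c.evaln r.2.2.1 m = some r.2.2.2 ∧
      encode ((decode (α := List Bool × ℕ × ℕ) m).getD default) = m ∧
      ((decode (α := List Bool × ℕ × ℕ) m).getD default).2.2 = r.2.1.1 ∧
      ((decode (α := List Bool × ℕ × ℕ) m).getD default).2.1 ≤ r.1 + b ∧
      ((decode (α := List Bool × ℕ × ℕ) m).getD default).1.length + r.1 + (2 * r.2.1.2 + b + 3) ≤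
        ((decode (α := List Bool × ℕ × ℕ) m).getD default).2.1 + r.2.1.1 :=
    hev.and <| (Primrec.eq.comp (Primrec.encode.comp hd) hm).and <|
      (Primrec.eq.comp ((Primrec.snd.comp Primrec.snd).comp hd) hn).and <|
      (Primrec.nat_le.comp hk (Primrec.nat_add.comp hj (Primrec.const b))).and <|
      Primrec.nat_le.comp
        (Primrec.nat_add.comp (Primrec.nat_add.comp
          (Primrec.list_length.comp (Primrec.fst.comp hd)) hj) ha)
        (Primrec.nat_add.comp hk hn)
  exact hrel.exists_mem_list.comp
    (Primrec.list_range.comp ((Primrec.fst.comp Primrec.snd).comp Primrec.snd)) Primrec.id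

theorem primrecPred_often_compressibleAt (c : Nat.Partrec.Code) (b : ℕ) :
    PrimrecPred fun r : (ℕ × ℕ) × ℕ × ℕ => r.1.1 ≤ 2 * ((List.range r.1.1).filter fun j =>
      CompressibleAt c b r.1.1 (2 * r.1.2 + b + 3) j r.2.2 r.2.1).length := by
  have hn : Primrec fun r : (ℕ × ℕ) × ℕ × ℕ => r.1.1 := Primrec.fst.comp Primrec.fst
  exact Primrec.nat_le.comp hn (Primrec.nat_mul.comp (Primrec.const 2)
    (Primrec.list_length.comp ((primrecPred_compressibleAt c b).listFilter.comp
      (Primrec.list_range.comp hn) Primrec.id)))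

namespace Machine

/-- A string that is compressible given at least half of the conditions is compressible. -/
theorem POptimal.exists_card_compressible_lt {Φ : Machine} (hΦ : Φ.POptimal) (b c₀ : ℕ) :
    ∃ a, ∀ n, 0 < n → ∀ x, n ≤ Φ.C x 0 n + c₀ →
      2 * {j ∈ Finset.range n | Φ.Compressible b n a j x}.card < n := by
  obtain ⟨code, hcode⟩ := Φ.exists_code
  obtain ⟨c, hc⟩ := hΦ.exists_C_add_le
    (fun r t x => r.1 ≤ 2 * ((List.range r.1).filter fun j =>
      CompressibleAt code b r.1 (2 * r.2 + b + 3) j x t).length)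
    (primrecPred_often_compressibleAt code b)
  have hlist : ∀ n a x t, ((List.range n).filter fun j => CompressibleAt code b n a j x t).length =
      {j ∈ Finset.range n | CompressibleAt code b n a j x t}.card := fun n a x t => by
    rw [← List.toFinset_card_of_nodup (List.nodup_range.filter _)]
    congr 1
    ext
    simp
  set e := c + c₀ + 1 with he
  refine ⟨2 * e + b + 3, fun n hn x hx => ?_⟩
  by_contra! hbad
  have hstage : ∃ T, ∀ j ∈ Finset.range n, Φ.Compressible b n (2 * e + b + 3) j x →
      CompressibleAt code b n (2 * e + b + 3) j x T := by
    have : ∀ j, ∃ T, Φ.Compressible b n (2 * e + b + 3) j x →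
        CompressibleAt code b n (2 * e + b + 3) j x T := fun j => by
      by_cases h : Φ.Compressible b n (2 * e + b + 3) j x
      · exact ((exists_compressibleAt_iff hcode ..).2 h).imp fun T hT _ => hT
      · exact ⟨0, fun h' => absurd h' h⟩
    choose T hT using this
    exact ⟨(Finset.range n).sup T, fun j hj h => (hT j h).mono (Finset.le_sup hj)⟩
  obtain ⟨T, hT⟩ := hstage
  have := hc n e x T ?_ ?_
  · omega
  · rw [hlist]
    refine hbad.trans (Nat.mul_le_mul_left 2 (Finset.card_le_card fun j hj => ?_))
    simp only [Finset.mem_filter] at hj ⊢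
    exact ⟨hj.1, hT j hj.1 hj.2⟩
  · intro s hs
    refine Φ.card_often_compressible_mul_le b n e hn s fun y hy => ?_
    obtain ⟨t, ht⟩ := hs y hy
    rw [hlist] at ht
    refine ht.trans (Nat.mul_le_mul_left 2 (Finset.card_le_card fun j hj => ?_))
    simp only [Finset.mem_filter] at hj ⊢
    exact ⟨hj.1, (exists_compressibleAt_iff hcode ..).1 ⟨t, hj.2⟩⟩

end Machine

/-- there is `ν > 0` such that every sufficiently long `x` with
`K(x) ≥ n − O(1)` has at least `ν·n` pairwise distinct weak sufficient set statistics. -/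
theorem stmt_12 (Φ Ψ : Machine) (hΦ : Φ.POptimal) (hΨ : Ψ.Optimal) (c₀ : ℕ) :
    ∃ ν : ℝ, 0 < ν ∧ ∃ c N₀ : ℕ, ∀ n : ℕ, N₀ ≤ n → ∀ x < 2 ^ n,
      n ≤ Φ.C x 0 n + c₀ →
      ∃ 𝒮 : Finset (Finset ℕ), ν * n ≤ (𝒮.card : ℝ) ∧
        ∀ S ∈ 𝒮, WeakSufficientSet Φ Ψ c n x S := by
  obtain ⟨b, hb⟩ := hΨ.exists_C_cylinder_le
  obtain ⟨c, hc⟩ := hΦ.exists_C_le_add hΨ.1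
  obtain ⟨a, ha⟩ := hΦ.exists_card_compressible_lt b c₀
  refine ⟨1 / 2, by norm_num, max c a, 1, fun n hn x hx hxn => ?_⟩
  set S : ℕ → Finset ℕ := fun j =>
    Finset.Ico (x / 2 ^ (n - j) * 2 ^ (n - j)) ((x / 2 ^ (n - j) + 1) * 2 ^ (n - j)) with hS
  have hcard : ∀ j, (S j).card = 2 ^ (n - j) := fun j => by simp [hS, add_mul]
  set J := {j ∈ Finset.range n | ¬ Φ.Compressible b n a j x} with hJ
  have hinj : Set.InjOn S J := by
    intro i hi j hj hij
    have h := congrArg Finset.card hij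
    rw [hcard, hcard] at h
    have h := Nat.pow_right_injective le_rfl h
    simp only [hJ, Finset.coe_filter, Finset.mem_range, Set.mem_ofPred_eq] at hi hj
    omega
  refine ⟨J.image S, ?_, ?_⟩
  · rw [Finset.card_image_of_injOn hinj]
    have h₁ := ha n hn x hxn
    have h₂ : {j ∈ Finset.range n | Φ.Compressible b n a j x}.card + J.card = n := by
      convert! Finset.card_filter_add_card_filter_not (s := Finset.range n)
        (fun j => Φ.Compressible b n a j x)
      exact (Finset.card_range n).symm
    have h₃ : n ≤ 2 * J.card := by omega
    have h₄ : (n : ℝ) ≤ 2 * J.card := by exact_mod_cast h₃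
    linarith
  · intro T hT
    obtain ⟨j, hj, rfl⟩ := Finset.mem_image.1 hT
    obtain ⟨hjn, hj⟩ := Finset.mem_filter.1 hj
    have hjn := Finset.mem_range.1 hjn
    have hdm := Nat.div_add_mod' x (2 ^ (n - j))
    have hmod := Nat.mod_lt x (Nat.two_pow_pos (n - j))
    refine ⟨?_, fun y hy => ?_, ?_⟩
    · simp only [hS, Finset.mem_Ico, add_mul]
      omega
    · have hpow : 2 ^ j * 2 ^ (n - j) = 2 ^ n := by rw [← pow_add, Nat.add_sub_cancel' hjn.le]
      have hdiv : x / 2 ^ (n - j) < 2 ^ j :=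
        Nat.div_lt_of_lt_mul (by rwa [mul_comm, hpow])
      simp only [hS, Finset.mem_Ico] at hy
      exact Finset.mem_range.2 (hy.2.trans_le ((Nat.mul_le_mul_right _ hdiv).trans_eq hpow))
    · rw [hcard, Nat.log_pow one_lt_two]
      have h₁ := hc n x (n - j)
      have h₂ := hb n x j hjn.le hx
      obtain ⟨p, hp, hlen⟩ := hΦ.2.1.exists_shortestProg x (Ψ.C (Encodable.encode (S j)) 0 n) n
      have h₃ : ¬ p.length + j + a ≤ Ψ.C (Encodable.encode (S j)) 0 n + n := fun h =>
        hj ⟨_, h₂, p, hp, h⟩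
      change Φ.C x (Ψ.C (Encodable.encode (S j)) 0 n) n ≤ _ at h₁
      change _ ≤ Ψ.C (Encodable.encode (S j)) 0 n + (n - j) + c at h₁
      rw [Nat.dist]
      omega
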